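/- arXiv:0912.1150 — 2 statements merged into one kernel-verified Lean document; each statement's English description precedes it below -/
import Mathlib

section
/- Suppose that for every fixed ℓ, the minimal blocking number b_ℓ(n) satisfies b_ℓ(n)/n → ∞ as n → ∞. Then for all integers k ≥ 2 and ℓ ≥ 1 there is an integer n such that every set P of at least n points in the plane either contains ℓ collinear points or has visibility graph with chromatic number χ(V(P)) ≥ k. -/
open Finset

def Blocks (B P : Set (ℝ × ℝ)) : Prop :=
  Disjoint B P ∧ ∀ v ∈ P, ∀ w ∈ P, v ≠ w → ∃ b ∈ B, b ∈ openSegment ℝ v w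

def Visible (P : Set (ℝ × ℝ)) (v w : ℝ × ℝ) : Prop :=
  v ≠ w ∧ ∀ p ∈ P, p ∉ openSegment ℝ v w

/-- `P` contains no `ℓ` collinear points. -/
def NoCollinear (ℓ : ℕ) (P : Finset (ℝ × ℝ)) : Prop :=
  ∀ S ⊆ P, S.card = ℓ → ¬ Collinear ℝ (S : Set (ℝ × ℝ))

theorem openSegment_sub_aux (v w p : ℝ × ℝ) (hp : p ∈ openSegment ℝ v w) (hvw : v ≠ w)
    (q : ℝ × ℝ) (hq : q ∈ openSegment ℝ v p) :
    v ≠ p ∧ q ∈ openSegment ℝ v w ∧ ‖q - v‖ < ‖p - v‖ := by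
  have hvp : v ≠ p := by
    rintro rfl
    exact hvw (left_mem_openSegment_iff.1 hp)
  refine ⟨hvp, ?_, ?_⟩
  · rw [openSegment_eq_image_lineMap] at hp hq ⊢
    obtain ⟨s, ⟨hs0, hs1⟩, rfl⟩ := hp
    obtain ⟨t, ⟨ht0, ht1⟩, rfl⟩ := hq
    refine ⟨t * s, ⟨by positivity, by nlinarith⟩, ?_⟩
    simp [AffineMap.lineMap_apply, mul_smul]
  · rw [openSegment_eq_image_lineMap] at hq
    obtain ⟨t, ⟨ht0, ht1⟩, rfl⟩ := hq
    have h1 : AffineMap.lineMap v p t - v = t • (p - v) := by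
      simp [AffineMap.lineMap_apply]
    rw [h1, norm_smul, Real.norm_of_nonneg ht0.le]
    have : 0 < ‖p - v‖ := norm_pos_iff.2 (sub_ne_zero.2 hvp.symm)
    nlinarith

theorem exists_visible_aux (P : Finset (ℝ × ℝ)) (v w : ℝ × ℝ) (hvw : v ≠ w)
    (h : ¬ Visible (P : Set (ℝ × ℝ)) v w) :
    ∃ p ∈ P, p ∈ openSegment ℝ v w ∧ Visible (P : Set (ℝ × ℝ)) v p := by
  classical
  have hne : (P.filter (fun p => p ∈ openSegment ℝ v w)).Nonempty := by
    by_contra hcon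
    apply h
    refine ⟨hvw, fun p hp hps => hcon ⟨p, by simpa using ⟨hp, hps⟩⟩⟩
  obtain ⟨p, hp, hmin⟩ := Finset.exists_min_image _ (fun p => ‖p - v‖) hne
  rw [Finset.mem_filter] at hp
  refine ⟨p, hp.1, hp.2, ?_, ?_⟩
  · rintro rfl
    exact hvw (left_mem_openSegment_iff.1 hp.2)
  · intro q hqP hq
    obtain ⟨-, h2, h3⟩ := openSegment_sub_aux v w p hp.2 hvw q hq
    have := hmin q (Finset.mem_filter.2 ⟨by simpa using hqP, h2⟩)
    linarith

/-- If for every fixed `ℓ` the minimal blocking number `b_ℓ(n)` is super-linear in `n`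
(that is, blocking sets for large `n`-point sets with no `ℓ` collinear points must have
size at least `C·n` for every constant `C`), then for all `k ≥ 2` and `ℓ ≥ 1` every
sufficiently large point set either has `ℓ` collinear points or has visibility graph
with chromatic number at least `k`. -/
theorem superlinear_blocking_implies_big_chromatic
    (hsup : ∀ ℓ : ℕ, ∀ C : ℝ, ∃ N : ℕ, ∀ P : Finset (ℝ × ℝ), N ≤ P.card →
      NoCollinear ℓ P → ∀ B : Finset (ℝ × ℝ),
        Blocks (B : Set (ℝ × ℝ)) (P : Set (ℝ × ℝ)) → C * P.card ≤ B.card) :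
    ∀ k ℓ : ℕ, 2 ≤ k → 1 ≤ ℓ → ∃ n : ℕ, ∀ P : Finset (ℝ × ℝ), n ≤ P.card →
      (∃ S ⊆ P, S.card = ℓ ∧ Collinear ℝ (S : Set (ℝ × ℝ))) ∨
      ∀ c : ℝ × ℝ → Fin (k - 1), ∃ v ∈ P, ∃ w ∈ P,
        Visible (P : Set (ℝ × ℝ)) v w ∧ c v = c w := by
  classical
  intro k ℓ hk _
  obtain ⟨N, hN⟩ := hsup ℓ k
  refine ⟨(k - 1) * (N + 1), fun P hP => ?_⟩
  by_cases hcol : ∃ S ⊆ P, S.card = ℓ ∧ Collinear ℝ (S : Set (ℝ × ℝ))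
  · exact Or.inl hcol
  refine Or.inr fun c => ?_
  by_contra hc
  have hc' : ∀ v ∈ P, ∀ w ∈ P, Visible (P : Set (ℝ × ℝ)) v w → c v ≠ c w :=
    fun v hv w hw hvis he => hc ⟨v, hv, w, hw, hvis, he⟩
  have hpig : ∃ i : Fin (k - 1), P.card ≤ (k - 1) * (P.filter (fun x => c x = i)).card := by
    by_contra! hcon
    have hsum := Finset.card_eq_sum_card_fiberwise (f := c) (s := P) (t := Finset.univ)
      (fun x _ => by simp)
    have hlt : ∑ i : Fin (k - 1), (k - 1) * (P.filter (fun x => c x = i)).card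
        < ∑ _i : Fin (k - 1), P.card :=
      Finset.sum_lt_sum_of_nonempty ⟨⟨0, by omega⟩, Finset.mem_univ _⟩ (fun i _ => hcon i)
    rw [← Finset.mul_sum, ← hsum] at hlt
    simp at hlt
  obtain ⟨i, hi⟩ := hpig
  set S := P.filter (fun x => c x = i) with hS
  have hSP : S ⊆ P := Finset.filter_subset _ _
  have hSN : N + 1 ≤ S.card := Nat.le_of_mul_le_mul_left (hP.trans hi) (by omega)
  have hb := hN S (by omega)
    (fun T hT hcard hTcol => hcol ⟨T, hT.trans hSP, hcard, hTcol⟩) (P \ S) (by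
      refine ⟨?_, ?_⟩
      · exact_mod_cast Finset.sdiff_disjoint
      · intro v hv w hw hvw
        have hv' := Finset.mem_filter.1 (Finset.mem_coe.1 hv)
        have hw' := Finset.mem_filter.1 (Finset.mem_coe.1 hw)
        obtain ⟨p, hp, hps, hvis⟩ := exists_visible_aux P v w hvw
          (fun hvis => hc' v hv'.1 w hw'.1 hvis (hv'.2.trans hw'.2.symm))
        refine ⟨p, ?_, hps⟩
        rw [Finset.mem_coe, Finset.mem_sdiff]
        refine ⟨hp, fun hpS => ?_⟩
        exact hc' v hv'.1 p hp hvis (hv'.2.trans (Finset.mem_filter.1 hpS).2.symm))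
  have hb' : k * S.card ≤ (P \ S).card := by exact_mod_cast hb
  have h1 : (P \ S).card ≤ P.card := Finset.card_le_card Finset.sdiff_subset
  have h2 : k * S.card ≤ (k - 1) * S.card := by omega
  have h3 := Nat.le_of_mul_le_mul_right h2 (by omega)
  omega
end

section
/- Let n points be equally spaced on a circle. Any point of the plane other than the circle's centre lies in the open chords of at most 7 pairs of the n points; consequently, any blocking set for these n points has at least (n(n-1)/2 - ⌊n/2⌋)/7 points, which is n²/14 - O(n). -/
open Finset Real
noncomputable section
open scoped Classical

/-- The `n` equally spaced points on the unit circle. -/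
def regularNgon (n : ℕ) : Finset (ℝ × ℝ) :=
  (Finset.range n).image (fun k =>
    (Real.cos (2 * π * k / n), Real.sin (2 * π * k / n)))

namespace NG

section alg
variable {F : Type*} [Field F]

lemma quad_card (a b c : F) (h : ¬ (a = 0 ∧ b = 0 ∧ c = 0)) (S : Finset F)
    (hS : ∀ u ∈ S, a * u ^ 2 + b * u + c = 0) : S.card ≤ 2 := by
  by_contra! hc
  obtain ⟨x, hx, y, hy, z, hz, hxy, hxz, hyz⟩ := Finset.two_lt_card.1 hc
  have h1 := hS x hx
  have h2 := hS y hy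
  have h3 := hS z hz
  have e1 : a * (x + y) + b = 0 := by
    apply mul_left_cancel₀ (sub_ne_zero.2 hxy); linear_combination h1 - h2
  have e2 : a * (x + z) + b = 0 := by
    apply mul_left_cancel₀ (sub_ne_zero.2 hxz); linear_combination h1 - h3
  have ha : a = 0 := by
    apply mul_left_cancel₀ (sub_ne_zero.2 hyz); linear_combination e1 - e2
  subst ha
  have hb : b = 0 := by linear_combination e1
  subst hb
  exact h ⟨rfl, rfl, by linear_combination h1⟩

lemma lin_card (b c : F) (h : ¬ (b = 0 ∧ c = 0)) (S : Finset F)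
    (hS : ∀ u ∈ S, b * u + c = 0) : S.card ≤ 1 := by
  rw [Finset.card_le_one]
  intro x hx y hy
  by_contra hxy
  have h1 := hS x hx
  have h2 := hS y hy
  have hb : b = 0 := by
    apply mul_left_cancel₀ (sub_ne_zero.2 hxy); linear_combination h1 - h2
  subst hb
  exact h ⟨rfl, by linear_combination h1⟩

open Polynomial in
lemma quart_card (a b c d e : F) (h : b ≠ 0) (S : Finset F)
    (hS : ∀ u ∈ S, a * u ^ 4 + b * u ^ 3 + c * u ^ 2 + d * u + e = 0) : S.card ≤ 4 := by
  set P : F[X] := C a * X ^ 4 + C b * X ^ 3 + C c * X ^ 2 + C d * X + C e with hP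
  have hP0 : P ≠ 0 := by
    intro h0
    have : P.coeff 3 = 0 := by rw [h0]; simp
    apply h
    simpa [hP, coeff_X, coeff_C, coeff_X_pow] using this
  have hd : P.natDegree ≤ 4 := by rw [hP]; compute_degree
  refine le_trans (card_le_degree_of_subset_roots (p := P) ?_) hd
  intro u hu
  rw [mem_roots hP0, IsRoot.def]
  have := hS u hu
  simp [hP]; exact this

lemma quad_vieta {a b c x y : F} (hxy : x ≠ y) (h1 : a * x ^ 2 + b * x + c = 0)
    (h2 : a * y ^ 2 + b * y + c = 0) : a * (x + y) = - b ∧ a * (x * y) = c := by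
  have e1 : a * (x + y) = - b := by
    apply mul_left_cancel₀ (sub_ne_zero.2 hxy); linear_combination h1 - h2
  exact ⟨e1, by linear_combination x * e1 - h1⟩

lemma quart_vieta {a b c d e x y z w : F} (hxy : x ≠ y) (hxz : x ≠ z) (hxw : x ≠ w)
    (hyz : y ≠ z) (hyw : y ≠ w) (hzw : z ≠ w)
    (h1 : a * x ^ 4 + b * x ^ 3 + c * x ^ 2 + d * x + e = 0)
    (h2 : a * y ^ 4 + b * y ^ 3 + c * y ^ 2 + d * y + e = 0)
    (h3 : a * z ^ 4 + b * z ^ 3 + c * z ^ 2 + d * z + e = 0)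
    (h4 : a * w ^ 4 + b * w ^ 3 + c * w ^ 2 + d * w + e = 0) :
    a * (x + y + z + w) = - b ∧
    a * (x * y + x * z + x * w + y * z + y * w + z * w) = c := by
  have D : ∀ t, x ≠ t → a * t ^ 4 + b * t ^ 3 + c * t ^ 2 + d * t + e = 0 →
      a * (x ^ 3 + x ^ 2 * t + x * t ^ 2 + t ^ 3) + b * (x ^ 2 + x * t + t ^ 2)
        + c * (x + t) + d = 0 := by
    intro t ht h
    apply mul_left_cancel₀ (sub_ne_zero.2 ht); linear_combination h1 - h
  have k2 := D y hxy h2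
  have k3 := D z hxz h3
  have k4 := D w hxw h4
  have m3 : a * (x ^ 2 + y ^ 2 + z ^ 2 + x * y + x * z + y * z) + b * (x + y + z) + c = 0 := by
    apply mul_left_cancel₀ (sub_ne_zero.2 hyz); linear_combination k2 - k3
  have m4 : a * (x ^ 2 + y ^ 2 + w ^ 2 + x * y + x * w + y * w) + b * (x + y + w) + c = 0 := by
    apply mul_left_cancel₀ (sub_ne_zero.2 hyw); linear_combination k2 - k4
  have e1 : a * (x + y + z + w) = - b := by
    apply mul_left_cancel₀ (sub_ne_zero.2 hzw); linear_combination m3 - m4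
  exact ⟨e1, by linear_combination (x + y + z) * e1 - m3⟩

/-- the three conditions on the product `u` of the endpoints of a chord -/
def G1 (p p' q q' u : F) : Prop := (p + p' * u) ^ 2 - 2 * u - q - q' * u ^ 2 = 0
def G2 (p p' q q' u : F) : Prop := (p + p' * u) ^ 2 - 2 * u + q + q' * u ^ 2 = 0
def G3 (p p' q q' u : F) : Prop :=
  (p + p' * u) ^ 2 * ((p + p' * u) ^ 2 - 4 * u) - (q - q' * u ^ 2) ^ 2 = 0

variable [CharZero F]

lemma G1_card {p p' q q' : F} (hr : p * p' ≠ 1) (S : Finset F)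
    (hS : ∀ u ∈ S, G1 p p' q q' u) : S.card ≤ 2 := by
  apply quad_card (p' ^ 2 - q') (2 * (p * p' - 1)) (p ^ 2 - q) _ S
  · intro u hu
    have := hS u hu
    unfold G1 at this
    linear_combination this
  · rintro ⟨-, h, -⟩
    apply hr
    have : p * p' - 1 = 0 := by simpa using h
    linear_combination this

lemma G2_card {p p' q q' : F} (hr : p * p' ≠ 1) (S : Finset F)
    (hS : ∀ u ∈ S, G2 p p' q q' u) : S.card ≤ 2 := by
  apply G1_card (p := p) (p' := p') (q := -q) (q' := -q') hr S
  intro u hu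
  have := hS u hu
  unfold G2 at this
  unfold G1
  linear_combination this

lemma G3_card {p p' q q' : F} (hp' : p' ≠ 0) (hr : p * p' ≠ 1) (S : Finset F)
    (hS : ∀ u ∈ S, G3 p p' q q' u) : S.card ≤ 4 := by
  apply quart_card (p' ^ 4 - q' ^ 2) (4 * p' ^ 2 * (p * p' - 1))
    (6 * (p * p') ^ 2 - 8 * (p * p') + 2 * (q * q')) (4 * p ^ 2 * (p * p' - 1)) (p ^ 4 - q ^ 2) _ S
  · intro u hu
    have := hS u hu
    unfold G3 at this
    linear_combination this
  · have : p * p' - 1 ≠ 0 := sub_ne_zero.2 hr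
    simp [hp', this]

/-- key identity for eight chords -/
lemma key {p p' q q' u1 u2 u3 u4 v1 v2 v3 v4 : F} (hr : p * p' ≠ 1)
    (h12 : u1 ≠ u2) (h34 : u3 ≠ u4) (hxy : v1 ≠ v2) (hxz : v1 ≠ v3) (hxw : v1 ≠ v4)
    (hyz : v2 ≠ v3) (hyw : v2 ≠ v4) (hzw : v3 ≠ v4)
    (a1 : G1 p p' q q' u1) (a2 : G1 p p' q q' u2) (a3 : G2 p p' q q' u3) (a4 : G2 p p' q q' u4)
    (b1 : G3 p p' q q' v1) (b2 : G3 p p' q q' v2) (b3 : G3 p p' q q' v3) (b4 : G3 p p' q q' v4)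
    (hp' : p' ≠ 0) :
    (p' ^ 4 - q' ^ 2) ≠ 0 ∧ u1 + u2 + u3 + u4 = v1 + v2 + v3 + v4 ∧
    (p' ^ 4 - q' ^ 2) * (u1 * u2 * u3 * u4) = p ^ 4 - q ^ 2 ∧
    (u1 ^ 2 + u2 ^ 2 + u3 ^ 2 + u4 ^ 2 + (v1 ^ 2 + v2 ^ 2 + v3 ^ 2 + v4 ^ 2) = 0 →
      (p' ^ 4 - q' ^ 2) * (3 * (p * p') - 1) = 4 * p' ^ 4 * (p * p' - 1)) := by
  have hr' : p * p' - 1 ≠ 0 := sub_ne_zero.2 hr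
  unfold G1 at a1 a2
  unfold G2 at a3 a4
  unfold G3 at b1 b2 b3 b4
  obtain ⟨s1, t1⟩ := quad_vieta (a := p' ^ 2 - q') (b := 2 * (p * p' - 1)) (c := p ^ 2 - q) h12
    (by linear_combination a1) (by linear_combination a2)
  obtain ⟨s2, t2⟩ := quad_vieta (a := p' ^ 2 + q') (b := 2 * (p * p' - 1)) (c := p ^ 2 + q) h34
    (by linear_combination a3) (by linear_combination a4)
  obtain ⟨s3, t3⟩ := quart_vieta (a := p' ^ 4 - q' ^ 2) (b := 4 * p' ^ 2 * (p * p' - 1))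
    (c := 6 * (p * p') ^ 2 - 8 * (p * p') + 2 * (q * q')) (d := 4 * p ^ 2 * (p * p' - 1))
    (e := p ^ 4 - q ^ 2) hxy hxz hxw hyz hyw hzw
    (by linear_combination b1) (by linear_combination b2) (by linear_combination b3)
    (by linear_combination b4)
  have hL : (p' ^ 4 - q' ^ 2) ≠ 0 := by
    intro h0
    rw [h0] at s3
    have : 4 * p' ^ 2 * (p * p' - 1) ≠ 0 := by simp [hp', hr']
    apply this
    linear_combination s3
  have hE : u1 + u2 + u3 + u4 = v1 + v2 + v3 + v4 := by
    apply mul_left_cancel₀ hL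
    linear_combination (p' ^ 2 + q') * s1 + (p' ^ 2 - q') * s2 - s3
  have hP : (p' ^ 4 - q' ^ 2) * (u1 * u2 * u3 * u4) = p ^ 4 - q ^ 2 := by
    linear_combination (p' ^ 2 + q') * (u3 * u4) * t1 + (p ^ 2 - q) * t2
  refine ⟨hL, hE, hP, fun hsq => ?_⟩
  set L := p' ^ 4 - q' ^ 2 with hLdef
  set e2u := u1 * u2 + u3 * u4 + (u1 + u2) * (u3 + u4) with he2u
  set e2v := v1 * v2 + v1 * v3 + v1 * v4 + v2 * v3 + v2 * v4 + v3 * v4 with he2v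
  have f1 : e2u + e2v = (v1 + v2 + v3 + v4) ^ 2 := by
    have : 2 * (e2u + e2v) = 2 * (v1 + v2 + v3 + v4) ^ 2 := by
      rw [he2u, he2v]
      linear_combination (u1 + u2 + u3 + u4 + v1 + v2 + v3 + v4) * hE - hsq
    exact mul_left_cancel₀ two_ne_zero this
  have f2 : L * e2u = 2 * (p * p') ^ 2 - 2 * (q * q') + 4 * (p * p' - 1) ^ 2 := by
    rw [he2u, hLdef]
    linear_combination (p' ^ 2 + q') * t1 + (p' ^ 2 - q') * t2 +
      (p' ^ 2 + q') * (u3 + u4) * s1 - 2 * (p * p' - 1) * s2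
  have f3 : (4 * (p * p' - 1)) * (L * (3 * (p * p') - 1)) =
      (4 * (p * p' - 1)) * (4 * p' ^ 4 * (p * p' - 1)) := by
    linear_combination L ^ 2 * f1 - L * f2 - L * t3 +
      (L * (v1 + v2 + v3 + v4) - 4 * p' ^ 2 * (p * p' - 1)) * s3
  exact mul_left_cancel₀ (by simp [hr']) f3

lemma G1_inv {p p' q q' u : F} (hu : u ≠ 0) (h : G1 p p' q q' u) : G1 p' p q' q u⁻¹ := by
  unfold G1 at *
  field_simp
  linear_combination h

lemma G2_inv {p p' q q' u : F} (hu : u ≠ 0) (h : G2 p p' q q' u) : G2 p' p q' q u⁻¹ := by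
  unfold G2 at *
  field_simp
  linear_combination h

lemma G3_inv {p p' q q' u : F} (hu : u ≠ 0) (h : G3 p p' q q' u) : G3 p' p q' q u⁻¹ := by
  unfold G3 at *
  field_simp
  linear_combination h

/-- final algebraic contradiction in the imaginary case -/
lemma imag_contra {r s x1 x2 y1 y2 : F} (σ : F →+* F) (hσr : σ r = s) (hr0 : r ≠ 0) (hr1 : r ≠ 1)
    (hx1 : σ x1 = x1 ^ 2 - 2) (hx2 : σ x2 = x2 ^ 2 - 2)
    (hy1 : σ y1 = y1 ^ 2 - 2) (hy2 : σ y2 = y2 ^ 2 - 2) (hx : x1 ≠ x2) (hy : y1 ≠ y2)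
    (ex1 : (r ^ 2 + s) * x1 ^ 2 + 4 * r * (1 - r) * x1 + (4 * r ^ 2 - 8 * r + 4 - 4 * s) = 0)
    (ex2 : (r ^ 2 + s) * x2 ^ 2 + 4 * r * (1 - r) * x2 + (4 * r ^ 2 - 8 * r + 4 - 4 * s) = 0)
    (ey1 : (r ^ 2 + s) * y1 ^ 2 + (- (4 * r * (1 - r))) * y1 + (4 * r ^ 2 - 8 * r) = 0)
    (ey2 : (r ^ 2 + s) * y2 ^ 2 + (- (4 * r * (1 - r))) * y2 + (4 * r ^ 2 - 8 * r) = 0) :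
    False := by
  have hr1' : 1 - r ≠ 0 := sub_ne_zero.2 (Ne.symm hr1)
  obtain ⟨a1, a2⟩ := quad_vieta hx ex1 ex2
  obtain ⟨b1, b2⟩ := quad_vieta hy ey1 ey2
  have hA : r ^ 2 + s ≠ 0 := by
    intro h0
    rw [h0] at b1
    have : 4 * r * (1 - r) ≠ 0 := by simp [hr0, hr1']
    apply this; linear_combination -b1
  obtain ⟨e, he⟩ : ∃ e, e = y1 + y2 := ⟨_, rfl⟩
  obtain ⟨X, hX⟩ : ∃ X, X = x1 * x2 := ⟨_, rfl⟩
  obtain ⟨Y, hY⟩ : ∃ Y, Y = y1 * y2 := ⟨_, rfl⟩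
  have hs0 : x1 + x2 + y1 + y2 = 0 := by
    apply mul_left_cancel₀ hA; linear_combination a1 + b1
  have hs1 : x1 ^ 2 + x2 ^ 2 + y1 ^ 2 + y2 ^ 2 - 8 = 0 := by
    have := congrArg σ hs0
    simp only [map_add, hx1, hx2, hy1, hy2, map_zero] at this
    linear_combination this
  have hs2 : (x1 ^ 2 - 2) ^ 2 + (x2 ^ 2 - 2) ^ 2 + (y1 ^ 2 - 2) ^ 2 + (y2 ^ 2 - 2) ^ 2 - 8 = 0 := by
    have := congrArg σ hs1
    simp only [map_add, map_sub, map_pow, hx1, hx2, hy1, hy2, map_zero, map_ofNat] at this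
    linear_combination this
  have hXY : X + Y = e ^ 2 - 4 := by
    have : 2 * (X + Y) = 2 * (e ^ 2 - 4) := by
      rw [hX, hY, he]
      linear_combination (x1 + x2 - y1 - y2) * hs0 - hs1
    exact mul_left_cancel₀ two_ne_zero this
  have hxe : x1 + x2 = - e := by rw [he]; linear_combination hs0
  have hXY2 : X * Y = 2 := by
    have : 4 * (X * Y) = 4 * 2 := by
      have k1 : x1 ^ 2 + x2 ^ 2 = e ^ 2 - 2 * X := by
        rw [hX]; linear_combination (x1 + x2 - e) * hxe
      have k2 : y1 ^ 2 + y2 ^ 2 = e ^ 2 - 2 * Y := by rw [hY, he]; ring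
      have k3 : x1 ^ 4 + x2 ^ 4 = (e ^ 2 - 2 * X) ^ 2 - 2 * X ^ 2 := by
        rw [← k1, hX]; ring
      have k4 : y1 ^ 4 + y2 ^ 4 = (e ^ 2 - 2 * Y) ^ 2 - 2 * Y ^ 2 := by
        rw [← k2, hY]; ring
      have k5 : (e ^ 2 - 2 * X) ^ 2 - 2 * X ^ 2 + ((e ^ 2 - 2 * Y) ^ 2 - 2 * Y ^ 2) = 24 := by
        rw [← k3, ← k4]; linear_combination hs2 + 4 * hs1
      linear_combination (2 * (X + Y) + 2 * (e ^ 2 - 4) - 4 * e ^ 2) * hXY - k5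
    exact mul_left_cancel₀ (by norm_num : (4 : F) ≠ 0) this
  rw [← he] at b1
  rw [← hX] at a2
  rw [← hY] at b2
  have i1 : e * r = 1 - 3 * r := by
    have : (4 * (1 - r)) * (e * r) = (4 * (1 - r)) * (1 - 3 * r) := by
      linear_combination a2 + b2 - (r ^ 2 + s) * hXY - e * b1
    exact mul_left_cancel₀ (by simp [hr1']) this
  have rk : r * (e + 3) = 1 := by linear_combination i1
  have sk : e * s * (e + 3) ^ 2 = 3 * e + 8 := by
    linear_combination (e + 3) ^ 2 * b1 - (e * (r * (e + 3) + 1)) * rk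
      + 4 * (e + 3) * rk - 4 * (r * (e + 3) + 1) * rk
  have hYe : (e + 2) * Y = - e * (2 * e + 5) := by
    have h1 : (1 + s * (e + 3) ^ 2) * Y = 4 - 8 * (e + 3) := by
      linear_combination (e + 3) ^ 2 * b2 - Y * (r * (e + 3) + 1) * rk
        + 4 * (r * (e + 3) + 1) * rk - 8 * (e + 3) * rk
    have : 4 * ((e + 2) * Y) = 4 * (- e * (2 * e + 5)) := by
      linear_combination e * h1 - Y * sk
    exact mul_left_cancel₀ (by norm_num : (4 : F) ≠ 0) this
  have hσe : σ e = e ^ 2 - 4 - 2 * Y := by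
    rw [he, hY]; simp only [map_add, hy1, hy2]; ring
  have i2 : s * (e ^ 2 - 1 - 2 * Y) = 1 := by
    have := congrArg σ rk
    simp only [map_mul, map_add, map_one, map_ofNat, hσr, hσe] at this
    linear_combination this
  have hf : e ^ 4 + 9 * e ^ 3 + 27 * e ^ 2 + 24 * e - 8 = 0 := by
    have : (3 * e + 8) * ((e ^ 2 - 1) * (e + 2) + 2 * e * (2 * e + 5)) =
        e * (e + 2) * (e + 3) ^ 2 := by
      linear_combination (e * (e + 2) * (e + 3) ^ 2) * i2
        - ((e ^ 2 - 1) * (e + 2) + 2 * e * (2 * e + 5)) * sk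
        + 2 * (e * s * (e + 3) ^ 2) * hYe
    have h2 : 2 * (e ^ 4 + 9 * e ^ 3 + 27 * e ^ 2 + 24 * e - 8) = 2 * 0 := by
      linear_combination this
    exact mul_left_cancel₀ two_ne_zero h2
  have hg : 2 * e ^ 5 + 13 * e ^ 4 + 22 * e ^ 3 - 9 * e ^ 2 - 32 * e + 8 = 0 := by
    have hX' : X = e ^ 2 - 4 - Y := by linear_combination hXY
    rw [hX'] at hXY2
    linear_combination -(e + 2) ^ 2 * hXY2 + ((e ^ 2 - 4) * (e + 2)) * hYe
      - ((e + 2) * Y - e * (2 * e + 5)) * hYe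
  have : (16 : F) = 0 := by
    linear_combination (-87 + 183 * e + 13 * e ^ 2 - 91 * e ^ 3 - 26 * e ^ 4) * hf
      + (-85 + 104 * e + 78 * e ^ 2 + 13 * e ^ 3) * hg
  norm_num at this

def Ty (σ : F →+* F) (p p' u : F) : Prop :=
  (G1 p p' (σ p) (σ p') u ∧ σ u = u ^ 2) ∨ (G2 p p' (σ p) (σ p') u ∧ σ u = u ^ 2) ∨
    (G3 p p' (σ p) (σ p') u ∧ σ u = - u ^ 2)

lemma split3 (σ : F →+* F) (p p' : F) (U : Finset F) (hU : ∀ u ∈ U, Ty σ p p' u) :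
    ∃ A B C : Finset F, A ⊆ U ∧ B ⊆ U ∧ C ⊆ U ∧ U.card ≤ A.card + B.card + C.card ∧
    (∀ u ∈ A, G1 p p' (σ p) (σ p') u ∧ σ u = u ^ 2) ∧
    (∀ u ∈ B, G2 p p' (σ p) (σ p') u ∧ σ u = u ^ 2) ∧
    (∀ u ∈ C, G3 p p' (σ p) (σ p') u ∧ σ u = - u ^ 2) := by
  refine ⟨U.filter (fun u => G1 p p' (σ p) (σ p') u ∧ σ u = u ^ 2),
    U.filter (fun u => G2 p p' (σ p) (σ p') u ∧ σ u = u ^ 2),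
    U.filter (fun u => G3 p p' (σ p) (σ p') u ∧ σ u = - u ^ 2),
    Finset.filter_subset _ _, Finset.filter_subset _ _, Finset.filter_subset _ _, ?_,
    fun u hu => (Finset.mem_filter.1 hu).2, fun u hu => (Finset.mem_filter.1 hu).2,
    fun u hu => (Finset.mem_filter.1 hu).2⟩
  have : U ⊆ (U.filter (fun u => G1 p p' (σ p) (σ p') u ∧ σ u = u ^ 2) ∪
    U.filter (fun u => G2 p p' (σ p) (σ p') u ∧ σ u = u ^ 2)) ∪
    U.filter (fun u => G3 p p' (σ p) (σ p') u ∧ σ u = - u ^ 2) := by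
    intro u hu
    simp only [Finset.mem_union, Finset.mem_filter]
    rcases hU u hu with h | h | h
    · exact Or.inl (Or.inl ⟨hu, h⟩)
    · exact Or.inl (Or.inr ⟨hu, h⟩)
    · exact Or.inr ⟨hu, h⟩
  refine (Finset.card_le_card this).trans ((Finset.card_union_le _ _).trans ?_)
  gcongr
  exact Finset.card_union_le _ _

lemma base_real (σ : F →+* F) (p : F) (U : Finset F) (hp : p ≠ 0) (hr : p * p ≠ 1)
    (hU : ∀ u ∈ U, Ty σ p p u) (h0 : ∀ u ∈ U, p + p * u ≠ 0) : U.card ≤ 6 := by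
  obtain ⟨A, B, C, hA, hB, hC, hc, tA, tB, tC⟩ := split3 σ p p U hU
  have cA := G1_card hr A (fun u hu => (tA u hu).1)
  have cB := G2_card hr B (fun u hu => (tB u hu).1)
  have cC : C.card ≤ 2 := by
    apply quad_card (p ^ 4 - σ p ^ 2) (2 * p ^ 4 - 4 * p ^ 2 + 2 * σ p ^ 2) (p ^ 4 - σ p ^ 2) _ C
    · intro u hu
      have h1 := (tC u hu).1
      have h2 := h0 u (hC hu)
      have h3 : 1 + u ≠ 0 := by
        intro h; apply h2; linear_combination p * h
      unfold G3 at h1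
      apply mul_left_cancel₀ (pow_ne_zero 2 h3)
      linear_combination h1
    · rintro ⟨h1, h2, -⟩
      apply hr
      have h3 : (4 * p ^ 2) * (p * p) = (4 * p ^ 2) * 1 := by linear_combination h2 + 2 * h1
      exact mul_left_cancel₀ (by simp [hp]) h3
  omega

lemma inv_eq_of_add_inv_eq {u v : F} (hu : u ≠ 0) (hv : v ≠ 0) (huv : u ≠ v)
    (h : u + u⁻¹ = v + v⁻¹) : u * v = 1 := by
  field_simp at h
  apply mul_left_cancel₀ (sub_ne_zero.2 huv)
  linear_combination h

lemma base_imag (σ : F →+* F) (p : F) (U : Finset F) (hp : p ≠ 0) (hr : p * (-p) ≠ 1)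
    (hU : ∀ u ∈ U, Ty σ p (-p) u) (h0 : ∀ u ∈ U, u ≠ 0) : U.card ≤ 6 := by
  by_contra! hcard
  obtain ⟨A, B, C, hA, hB, hC, hc, tA, tB, tC⟩ := split3 σ p (-p) U hU
  have cA := G1_card hr A (fun u hu => (tA u hu).1)
  have cB := G2_card hr B (fun u hu => (tB u hu).1)
  have cC := G3_card (neg_ne_zero.2 hp) hr C (fun u hu => (tC u hu).1)
  have hq : σ p ≠ 0 := by simpa using hp
  -- the two x-values
  have hx : ∃ u1 u2, u1 ≠ 0 ∧ u2 ≠ 0 ∧ σ u1 = u1 ^ 2 ∧ σ u2 = u2 ^ 2 ∧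
      u1 + u1⁻¹ ≠ u2 + u2⁻¹ ∧
      ((p - p * u1) ^ 2 - 2 * u1) ^ 2 = (σ p) ^ 2 * (1 - u1 ^ 2) ^ 2 ∧
      ((p - p * u2) ^ 2 - 2 * u2) ^ 2 = (σ p) ^ 2 * (1 - u2 ^ 2) ^ 2 := by
    have main : ∀ q : F, q ≠ 0 → ∀ S : Finset F, S ⊆ U → S.card = 2 →
      (∀ u ∈ S, (p - p * u) ^ 2 - 2 * u = q * (1 - u ^ 2) ∧ σ u = u ^ 2) →
      ∃ u1 u2, u1 ≠ 0 ∧ u2 ≠ 0 ∧ σ u1 = u1 ^ 2 ∧ σ u2 = u2 ^ 2 ∧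
      u1 + u1⁻¹ ≠ u2 + u2⁻¹ ∧
      ((p - p * u1) ^ 2 - 2 * u1) ^ 2 = q ^ 2 * (1 - u1 ^ 2) ^ 2 ∧
      ((p - p * u2) ^ 2 - 2 * u2) ^ 2 = q ^ 2 * (1 - u2 ^ 2) ^ 2 := by
      intro q hq S hS hS2 hq2
      obtain ⟨x, y, hxy, rfl⟩ := Finset.card_eq_two.1 hS2
      have hx0 := h0 x (hS (by simp))
      have hy0 := h0 y (hS (by simp))
      obtain ⟨x1, x2⟩ := hq2 x (by simp)
      obtain ⟨y1, y2⟩ := hq2 y (by simp)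
      refine ⟨x, y, hx0, hy0, x2, y2, ?_, by rw [x1]; ring, by rw [y1]; ring⟩
      intro h
      have h1 := inv_eq_of_add_inv_eq hx0 hy0 hxy h
      have h2 : 2 * q * (1 - x ^ 2) = 0 := by
        linear_combination -x1 + x ^ 2 * y1 + (- p ^ 2 * (x * y + 1) + 2 * p ^ 2 * x + 2 * x  - q * (x * y + 1)) * h1
      have h3 : 1 - x ^ 2 = 0 := by simpa [hq] using h2
      apply hxy
      apply mul_left_cancel₀ hx0
      linear_combination -h3 - h1
    by_cases hA2 : A.card = 2
    · apply main (σ p) hq A hA hA2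
      intro u hu
      obtain ⟨h1, h2⟩ := tA u hu
      refine ⟨?_, h2⟩
      unfold G1 at h1
      rw [map_neg] at h1
      linear_combination h1
    · have hB2 : B.card = 2 := by omega
      have := main (-σ p) (neg_ne_zero.2 hq) B hB hB2 ?_
      · simpa using this
      intro u hu
      obtain ⟨h1, h2⟩ := tB u hu
      refine ⟨?_, h2⟩
      unfold G2 at h1
      rw [map_neg] at h1
      linear_combination h1
  have hy : ∃ v1 v2, v1 ∈ C ∧ v2 ∈ C ∧ v1 + v1⁻¹ ≠ v2 + v2⁻¹ := by
    have : 2 < C.card := by omega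
    obtain ⟨x, hx, y, hy, z, hz, hxy, hxz, hyz⟩ := Finset.two_lt_card.1 this
    have hx0 := h0 x (hC hx)
    by_cases h : x + x⁻¹ = y + y⁻¹
    · refine ⟨x, z, hx, hz, fun h' => hyz ?_⟩
      have h1 := inv_eq_of_add_inv_eq hx0 (h0 y (hC hy)) hxy h
      have h2 := inv_eq_of_add_inv_eq hx0 (h0 z (hC hz)) hxz h'
      apply mul_left_cancel₀ hx0
      rw [h1, h2]
    · exact ⟨x, y, hx, hy, h⟩
  obtain ⟨u1, u2, hu1, hu2, s1, s2, hne, e1, e2⟩ := hx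
  obtain ⟨v1, v2, m1, m2, hne'⟩ := hy
  have hv1 := h0 v1 (hC m1)
  have hv2 := h0 v2 (hC m2)
  obtain ⟨f1, t1⟩ := tC v1 m1
  obtain ⟨f2, t2⟩ := tC v2 m2
  have X : ∀ u : F, u ≠ 0 → ((p - p * u) ^ 2 - 2 * u) ^ 2 = (σ p) ^ 2 * (1 - u ^ 2) ^ 2 →
      ((-p ^ 2) ^ 2 + (- σ p ^ 2)) * (u + u⁻¹) ^ 2 + 4 * (-p ^ 2) * (1 - (-p ^ 2)) * (u + u⁻¹)
        + (4 * (-p ^ 2) ^ 2 - 8 * (-p ^ 2) + 4 - 4 * (- σ p ^ 2)) = 0 := by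
    intro u hu h
    field_simp
    linear_combination h
  have Y : ∀ u : F, u ≠ 0 → G3 p (-p) (σ p) (σ (-p)) u →
      ((-p ^ 2) ^ 2 + (- σ p ^ 2)) * (-(u + u⁻¹)) ^ 2
        + (-(4 * (-p ^ 2) * (1 - (-p ^ 2)))) * (-(u + u⁻¹))
        + (4 * (-p ^ 2) ^ 2 - 8 * (-p ^ 2)) = 0 := by
    intro u hu h
    unfold G3 at h
    rw [map_neg] at h
    field_simp
    linear_combination h
  have SX : ∀ u : F, u ≠ 0 → σ u = u ^ 2 → σ (u + u⁻¹) = (u + u⁻¹) ^ 2 - 2 := by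
    intro u hu h
    rw [map_add, map_inv₀, h]
    field_simp
    ring
  have SY : ∀ u : F, u ≠ 0 → σ u = - u ^ 2 → σ (-(u + u⁻¹)) = (-(u + u⁻¹)) ^ 2 - 2 := by
    intro u hu h
    rw [map_neg, map_add, map_inv₀, h]
    field_simp
    ring
  refine imag_contra (r := - p ^ 2) (s := - σ p ^ 2) σ (by simp) (by simp [hp]) ?_
    (SX u1 hu1 s1) (SX u2 hu2 s2) (SY v1 hv1 t1) (SY v2 hv2 t2) hne
    (fun h => hne' (neg_injective h)) (X u1 hu1 e1) (X u2 hu2 e2) (Y v1 hv1 f1) (Y v2 hv2 f2)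
  intro h; apply hr; linear_combination h

lemma base_eight (σ : F →+* F) (p p' : F) (U : Finset F) (hp : p ≠ 0) (hp' : p' ≠ 0)
    (hr : p * p' ≠ 1)
    (hU : ∀ u ∈ U, Ty σ p p' u) (h0 : ∀ u ∈ U, u ≠ 0) (hc8 : 8 ≤ U.card) :
    (∃ u1 ∈ U, ∃ u2 ∈ U, ∃ u3 ∈ U, ∃ u4 ∈ U, p' ^ 4 * (u1 * u2 * u3 * u4) = p ^ 4) ∧
    σ p ^ 2 * p' ^ 4 = σ p' ^ 2 * p ^ 4 := by
  obtain ⟨A, B, C, hA, hB, hC, hc, tA, tB, tC⟩ := split3 σ p p' U hU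
  have cA := G1_card hr A (fun u hu => (tA u hu).1)
  have cB := G2_card hr B (fun u hu => (tB u hu).1)
  have cC := G3_card hp' hr C (fun u hu => (tC u hu).1)
  have hr' : p' * p ≠ 1 := by rwa [mul_comm]
  have hr1 : p * p' - 1 ≠ 0 := sub_ne_zero.2 hr
  obtain ⟨u1, u2, h12, rfl⟩ := Finset.card_eq_two.1 (by omega : A.card = 2)
  obtain ⟨u3, u4, h34, rfl⟩ := Finset.card_eq_two.1 (by omega : B.card = 2)
  obtain ⟨v1, C', hv1, rfl, hC'⟩ := Finset.card_eq_succ.1 (by omega : C.card = 3 + 1)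
  obtain ⟨v2, v3, v4, h23, h24, h34', rfl⟩ := Finset.card_eq_three.1 hC'
  simp only [Finset.mem_insert, Finset.mem_singleton, not_or] at hv1
  obtain ⟨w2, w3, w4⟩ := hv1
  have mu1 : u1 ∈ U := hA (by simp)
  have mu2 : u2 ∈ U := hA (by simp)
  have mu3 : u3 ∈ U := hB (by simp)
  have mu4 : u4 ∈ U := hB (by simp)
  have mv1 : v1 ∈ U := hC (by simp)
  have mv2 : v2 ∈ U := hC (by simp)
  have mv3 : v3 ∈ U := hC (by simp)
  have mv4 : v4 ∈ U := hC (by simp)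
  obtain ⟨a1, s1⟩ := tA u1 (by simp)
  obtain ⟨a2, s2⟩ := tA u2 (by simp)
  obtain ⟨a3, s3⟩ := tB u3 (by simp)
  obtain ⟨a4, s4⟩ := tB u4 (by simp)
  obtain ⟨b1, t1⟩ := tC v1 (by simp)
  obtain ⟨b2, t2⟩ := tC v2 (by simp)
  obtain ⟨b3, t3⟩ := tC v3 (by simp)
  obtain ⟨b4, t4⟩ := tC v4 (by simp)
  obtain ⟨hL, hE, hP, hK⟩ := key hr h12 h34 w2 w3 w4 h23 h24 h34' a1 a2 a3 a4 b1 b2 b3 b4 hp'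
  have i := fun {x y : F} (h : x ≠ y) => (fun h' => h (inv_injective h') : x⁻¹ ≠ y⁻¹)
  obtain ⟨hL', hE', hP', hK'⟩ := key hr' (i h12) (i h34) (i w2) (i w3) (i w4) (i h23) (i h24)
    (i h34') (G1_inv (h0 _ mu1) a1) (G1_inv (h0 _ mu2) a2) (G2_inv (h0 _ mu3) a3)
    (G2_inv (h0 _ mu4) a4) (G3_inv (h0 _ mv1) b1) (G3_inv (h0 _ mv2) b2) (G3_inv (h0 _ mv3) b3)
    (G3_inv (h0 _ mv4) b4) hp
  have k1 := hK (by
    have := congrArg σ hE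
    simp only [map_add, s1, s2, s3, s4, t1, t2, t3, t4] at this
    linear_combination this)
  have k2 := hK' (by
    have := congrArg σ hE'
    simp only [map_add, map_inv₀, s1, s2, s3, s4, t1, t2, t3, t4, inv_neg] at this
    simp only [inv_pow]
    linear_combination this)
  have h3r : 3 * (p * p') - 1 ≠ 0 := by
    intro h
    rw [h] at k1
    have : 4 * p' ^ 4 * (p * p' - 1) ≠ 0 := by simp [hp', hr1]
    apply this
    linear_combination -k1
  refine ⟨⟨u1, mu1, u2, mu2, u3, mu3, u4, mu4, ?_⟩, ?_⟩
  · have : (4 * (p * p' - 1)) * (p' ^ 4 * (u1 * u2 * u3 * u4)) = (4 * (p * p' - 1)) * p ^ 4 := by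
      linear_combination (3 * (p * p') - 1) * hP - (u1 * u2 * u3 * u4) * k1 + k2
    exact mul_left_cancel₀ (by simp [hr1]) this
  · apply mul_left_cancel₀ h3r
    linear_combination p ^ 4 * k1 - p' ^ 4 * k2

end alg

section gal
variable {F : Type*} [Field F] [CharZero F]

lemma exists_sigma {M k : ℕ} (hM : 0 < M) (hk : k.Coprime M) :
    ∃ σ : AlgebraicClosure ℚ →+* AlgebraicClosure ℚ, ∀ z, z ^ M = 1 → σ z = z ^ k := by
  have : NeZero M := ⟨hM.ne'⟩
  obtain ⟨ζ, hζ⟩ := HasEnoughRootsOfUnity.exists_primitiveRoot (AlgebraicClosure ℚ) M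
  have h2 := hζ.pow_of_coprime k hk
  have h : IsConjRoot ℚ ζ (ζ ^ k) := by
    rw [isConjRoot_def, ← Polynomial.cyclotomic_eq_minpoly_rat hζ hM,
      ← Polynomial.cyclotomic_eq_minpoly_rat h2 hM]
  have : Normal ℚ (AlgebraicClosure ℚ) := by
    have h := @IsAlgClosure.normal ℚ (AlgebraicClosure ℚ) _ _ (AlgebraicClosure.instAlgebra ℚ) _
    convert h
    exact Subsingleton.elim _ _
  obtain ⟨σ, hσ⟩ := isConjRoot_iff_exists_algEquiv.1 h.symm
  refine ⟨(σ : AlgebraicClosure ℚ →+* AlgebraicClosure ℚ), ?_⟩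
  intro z hz
  obtain ⟨i, -, rfl⟩ := hζ.eq_pow_of_pow_eq_one hz
  have : σ ζ = ζ ^ k := hσ
  simp [this, ← pow_mul, mul_comm]

def Chd (p p' : F) (M : ℕ) (u : F) : Prop :=
  ∃ z w, z ^ M = 1 ∧ w ^ M = 1 ∧ z * w = u ∧ z + w = p + p' * u ∧ z + w ≠ 0

lemma Chd.ne_zero {p p' u : F} {M : ℕ} (hM : 0 < M) (h : Chd p p' M u) : u ≠ 0 := by
  obtain ⟨z, w, hz, hw, rfl, -⟩ := h
  intro h0
  have : (z * w) ^ M = 1 := by rw [mul_pow, hz, hw, one_mul]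
  rw [h0, zero_pow hM.ne'] at this
  exact zero_ne_one this

lemma Chd.pow_eq {p p' u : F} {M : ℕ} (h : Chd p p' M u) : u ^ M = 1 := by
  obtain ⟨z, w, hz, hw, rfl, -⟩ := h
  rw [mul_pow, hz, hw, one_mul]

lemma rot {p p' u τ : F} {M : ℕ} (hτ : τ ≠ 0) (ht : τ ^ M = 1) (h : Chd p p' M u) :
    Chd (p * τ) (p' / τ) M (u * τ ^ 2) := by
  obtain ⟨z, w, hz, hw, rfl, h1, h2⟩ := h
  have e : z * τ + w * τ = (z + w) * τ := by ring
  refine ⟨z * τ, w * τ, by rw [mul_pow, hz, ht, one_mul], by rw [mul_pow, hw, ht, one_mul],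
    by ring, ?_, ?_⟩
  · rw [e, h1]; field_simp
  · rw [e]; exact mul_ne_zero h2 hτ

lemma rot_card {τ : F} (hτ : τ ≠ 0) (U : Finset F) :
    (U.image (fun u => u * τ ^ 2)).card = U.card :=
  Finset.card_image_of_injective _ (mul_left_injective₀ (pow_ne_zero 2 hτ))

abbrev Om := AlgebraicClosure ℚ

lemma base_ty {N : ℕ} {σ : Om →+* Om} (hs : ∀ z : Om, z ^ (2 * N) = 1 → σ z = z ^ (N + 2))
    {p p' u : Om} (h : Chd p p' (2 * N) u) : Ty σ p p' u := by
  obtain ⟨z, w, hz, hw, rfl, h1, h2⟩ := h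
  have sz := hs z hz
  have sw := hs w hw
  have h3 : σ z + σ w = σ p + σ p' * (σ z * σ w) := by
    have := congrArg σ h1
    simpa using this
  rw [mul_comm 2 N, pow_mul, sq_eq_one_iff] at hz hw
  rw [pow_add] at sz sw
  unfold Ty G1 G2 G3
  rw [← h1]
  rcases hz with hz | hz <;> rcases hw with hw | hw <;> rw [hz] at sz <;> rw [hw] at sw <;>
    rw [sz, sw] at h3
  · left
    refine ⟨by linear_combination h3, by rw [map_mul, sz, sw]; ring⟩
  · right; right
    refine ⟨?_, by rw [map_mul, sz, sw]; ring⟩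
    linear_combination (z ^ 2 - w ^ 2 + σ p - σ p' * (z * w) ^ 2) * h3
  · right; right
    refine ⟨?_, by rw [map_mul, sz, sw]; ring⟩
    linear_combination (w ^ 2 - z ^ 2 + σ p - σ p' * (z * w) ^ 2) * h3
  · right; left
    refine ⟨by linear_combination -h3, by rw [map_mul, sz, sw]; ring⟩

lemma base_diam {N : ℕ} (hN : Odd N) {σ : Om →+* Om}
    (hs : ∀ z : Om, z ^ (2 * N) = 1 → σ z = z ^ (N + 2))
    {p p' : Om} (hp : p ≠ 0) (hp' : p' ≠ 0) (hr : p * p' ≠ 1) (U : Finset Om)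
    (hU : ∀ u ∈ U, Chd p p' (2 * N) u) (hd : p ^ (2 * N) = p' ^ (2 * N)) : U.card ≤ 6 := by
  have hN0 : 0 < N := hN.pos
  obtain ⟨m, hm⟩ := hN
  have key : ∃ ε τ : Om, (ε = 1 ∨ ε = -1) ∧ τ ≠ 0 ∧ τ ^ N = 1 ∧ p' / τ = ε * (p * τ) := by
    have h1 : ((p / p') ^ N) ^ 2 = 1 := by
      rw [← pow_mul, mul_comm N 2, div_pow, hd, div_self (pow_ne_zero _ hp')]
    have h2 := sq_eq_one_iff.1 h1
    have hoN : Odd N := ⟨m, hm⟩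
    set ε := (p / p') ^ N with hε
    have e1 : ε ^ N = ε := by
      rcases h2 with h | h <;> rw [h]
      · simp
      · exact hoN.neg_one_pow
    have e0 : ε ≠ 0 := by rintro h; rw [h] at h1; simp at h1
    have e2 : (ε * (p / p')) ^ N = 1 := by
      rw [mul_pow, e1, ← hε, ← sq, h1]
    refine ⟨ε, ((ε * (p / p'))⁻¹) ^ (m + 1), h2, ?_, ?_, ?_⟩
    · exact pow_ne_zero _ (inv_ne_zero (mul_ne_zero e0 (div_ne_zero hp hp')))
    · rw [← pow_mul, mul_comm (m + 1) N, pow_mul, inv_pow _ N, e2]; simp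
    · have t2 : (((ε * (p / p'))⁻¹) ^ (m + 1)) ^ 2 = (ε * (p / p'))⁻¹ := by
        rw [← pow_mul, show (m + 1) * 2 = N + 1 by omega, pow_succ, inv_pow, e2]; simp
      have t0 : ((ε * (p / p'))⁻¹) ^ (m + 1) ≠ 0 :=
        pow_ne_zero _ (inv_ne_zero (mul_ne_zero e0 (div_ne_zero hp hp')))
      rw [div_eq_iff t0, mul_assoc, mul_assoc, ← sq, t2]
      field_simp
  obtain ⟨ε, τ, hε, hτ, ht, he⟩ := key
  have ht2 : τ ^ (2 * N) = 1 := by rw [mul_comm, pow_mul, ht, one_pow]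
  rw [← rot_card hτ U]
  have hU' : ∀ u ∈ U.image (fun u => u * τ ^ 2), Chd (p * τ) (p' / τ) (2 * N) u := by
    intro u hu
    obtain ⟨v, hv, rfl⟩ := Finset.mem_image.1 hu
    exact rot hτ ht2 (hU v hv)
  have hr' : p * τ * (p' / τ) ≠ 1 := by
    rw [show p * τ * (p' / τ) = p * p' by field_simp]; exact hr
  have hpt := mul_ne_zero hp hτ
  have hM : 0 < 2 * N := by omega
  rw [he] at hU' hr'
  rcases hε with rfl | rfl
  · rw [one_mul] at hU' hr'
    refine base_real σ (p * τ) _ hpt hr' (fun u hu => base_ty hs (hU' u hu)) ?_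
    intro u hu
    obtain ⟨z, w, -, -, rfl, h1, h2⟩ := hU' u hu
    rwa [h1] at h2
  · rw [neg_one_mul] at hU' hr'
    exact base_imag σ (p * τ) _ hpt hr' (fun u hu => base_ty hs (hU' u hu))
      (fun u hu => (hU' u hu).ne_zero hM)

lemma base_case {N : ℕ} (hN : Odd N)
    {p p' : Om} (hp : p ≠ 0) (hp' : p' ≠ 0) (hr : p * p' ≠ 1) (U : Finset Om)
    (hU : ∀ u ∈ U, Chd p p' (2 * N) u) :
    U.card ≤ 7 ∧ (p ^ (2 * N) = p' ^ (2 * N) → U.card ≤ 6) := by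
  have hN0 : 0 < N := hN.pos
  have hM : 0 < 2 * N := by omega
  have hco : (N + 2).Coprime (2 * N) := by
    have h2 : Nat.Coprime 2 N := (Nat.coprime_two_left).2 hN
    rw [Nat.coprime_mul_iff_right]
    constructor
    · rw [Nat.coprime_two_right]
      exact hN.add_even even_two
    · simpa using h2
  obtain ⟨σ, hs⟩ := exists_sigma hM hco
  have hd := base_diam hN hs hp hp' hr U hU
  refine ⟨?_, hd⟩
  by_contra! hc
  obtain ⟨⟨u1, m1, u2, m2, u3, m3, u4, m4, hP⟩, hS⟩ := base_eight σ p p' U hp hp' hr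
    (fun u hu => base_ty hs (hU u hu)) (fun u hu => (hU u hu).ne_zero hM) hc
  have : U.card ≤ 6 := by
    apply hd
    have hP' : (p / p') ^ 4 = u1 * u2 * u3 * u4 := by
      rw [div_pow, ← hP]; field_simp
    have h8 : ((p / p') ^ N) ^ 8 = 1 := by
      calc ((p / p') ^ N) ^ 8 = ((p / p') ^ 4) ^ (2 * N) := by ring
        _ = 1 := by
          rw [hP', mul_pow, mul_pow, mul_pow, (hU _ m1).pow_eq, (hU _ m2).pow_eq,
            (hU _ m3).pow_eq, (hU _ m4).pow_eq]; simp
    have hs2 : σ (p / p') ^ 2 = (p / p') ^ 4 := by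
      have : σ p' ≠ 0 := by simpa using hp'
      rw [map_div₀, div_pow, div_pow, div_eq_div_iff (pow_ne_zero _ this) (pow_ne_zero _ hp')]
      linear_combination hS
    have hs3 : σ ((p / p') ^ N) ^ 2 = ((p / p') ^ N) ^ 4 := by
      rw [map_pow, ← pow_mul, mul_comm, pow_mul, hs2]; ring
    set ω := (p / p') ^ N with hω
    have h4 : ω ^ 4 = 1 := by
      apply σ.injective
      rw [map_pow, map_one, show 4 = 2 * 2 by rfl, pow_mul, hs3, ← pow_mul]
      exact h8
    have h2 : ω ^ 2 = 1 := by
      apply σ.injective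
      rw [map_pow, map_one, hs3, h4]
    rw [hω, ← pow_mul, mul_comm N 2, div_pow, div_eq_one_iff_eq (pow_ne_zero _ hp')] at h2
    exact h2
  omega

end gal

section step

def Bd (M : ℕ) : Prop := ∀ (p p' : Om) (U : Finset Om), p ≠ 0 → p' ≠ 0 → p * p' ≠ 1 →
    (∀ u ∈ U, Chd p p' M u) → U.card ≤ 7 ∧ (p ^ M = p' ^ M → U.card ≤ 6)

lemma step {L : ℕ} (hL : Even L) (hL0 : 0 < L) (IH : Bd L) : Bd (2 * L) := by
  intro p p' U hp hp' hr hU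
  have hM : 0 < 2 * L := by omega
  have hco : (L + 1).Coprime (2 * L) := by
    rw [Nat.coprime_mul_iff_right]
    constructor
    · rw [Nat.coprime_two_right]
      exact hL.add_one
    · simp
  obtain ⟨σ, hs⟩ := exists_sigma hM hco
  have hsgn : ∀ z : Om, z ^ (2 * L) = 1 → (z ^ L = 1 ∧ σ z = z) ∨ (z ^ L = -1 ∧ σ z = -z) := by
    intro z hz
    have h1 := hs z hz
    rw [pow_succ] at h1
    rw [mul_comm 2 L, pow_mul, sq_eq_one_iff] at hz
    rcases hz with h | h
    · left; refine ⟨h, by rw [h1, h, one_mul]⟩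
    · right; refine ⟨h, by rw [h1, h, neg_one_mul]⟩
  have hrho : σ p * p' = p * σ p' → p ^ (2 * L) = p' ^ (2 * L) → p ^ L = p' ^ L := by
    intro h1 h2
    have h3 : (p / p') ^ (2 * L) = 1 := by
      rw [div_pow, h2, div_self (pow_ne_zero _ hp')]
    have h4 : σ (p / p') = p / p' := by
      have : σ p' ≠ 0 := by simpa using hp'
      rw [map_div₀, div_eq_div_iff this hp', h1]
    have h5 : (p / p') ^ L = 1 := by
      rcases hsgn _ h3 with h | h
      · exact h.1
      · exfalso
        have h6 := h.2.symm.trans h4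
        have : p / p' = 0 := by
          apply mul_left_cancel₀ (two_ne_zero (α := Om)); linear_combination -h6
        exact div_ne_zero hp hp' this
    rwa [div_pow, div_eq_one_iff_eq (pow_ne_zero _ hp')] at h5
  have two : (2 : Om) ≠ 0 := two_ne_zero
  have nz : ∀ z : Om, z ^ (2 * L) = 1 → z ≠ 0 := by
    rintro z hz rfl
    rw [zero_pow hM.ne'] at hz; exact zero_ne_one hz
  have cls : ∀ z w : Om, z ^ (2 * L) = 1 → w ^ (2 * L) = 1 → z + w = p + p' * (z * w) →
      (z ^ L = 1 ∧ w ^ L = 1 ∧ z + w = σ p + σ p' * (z * w)) ∨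
      (z ^ L = -1 ∧ w ^ L = -1 ∧ -(z + w) = σ p + σ p' * (z * w)) ∨
      (z - w = σ p - σ p' * (z * w) ∨ w - z = σ p - σ p' * (z * w)) := by
    intro z w hz hw h1
    have h3 : σ z + σ w = σ p + σ p' * (σ z * σ w) := by
      have := congrArg σ h1
      simpa using this
    rcases hsgn z hz with ⟨a, b⟩ | ⟨a, b⟩ <;> rcases hsgn w hw with ⟨c, d⟩ | ⟨c, d⟩ <;>
      rw [b, d] at h3
    · exact Or.inl ⟨a, c, h3⟩
    · exact Or.inr (Or.inr (Or.inl (by linear_combination h3)))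
    · exact Or.inr (Or.inr (Or.inr (by linear_combination h3)))
    · exact Or.inr (Or.inl ⟨a, c, by linear_combination h3⟩)
  by_cases hA : σ p = p ∧ σ p' = p'
  · have hU' : ∀ u ∈ U, Chd p p' L u := by
      intro u hu
      obtain ⟨z, w, hz, hw, rfl, h1, h2⟩ := hU u hu
      have hc := cls z w hz hw h1
      rw [hA.1, hA.2] at hc
      rcases hc with ⟨a, b, -⟩ | ⟨-, -, h⟩ | h | h
      · exact ⟨z, w, a, b, rfl, h1, h2⟩
      · exact absurd (mul_left_cancel₀ two (by linear_combination h1 - h :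
          2 * (z + w) = 2 * 0)) h2
      · have e1 : z = p := mul_left_cancel₀ two (by linear_combination h1 + h)
        have e2 : w = p' * (z * w) := mul_left_cancel₀ two (by linear_combination h1 - h)
        refine absurd (mul_left_cancel₀ (nz w hw) ?_) hr
        rw [← e1]; linear_combination -e2
      · have e1 : w = p := mul_left_cancel₀ two (by linear_combination h1 + h)
        have e2 : z = p' * (z * w) := mul_left_cancel₀ two (by linear_combination h1 - h)
        refine absurd (mul_left_cancel₀ (nz z hz) ?_) hr
        rw [← e1]; linear_combination -e2
    have := IH p p' U hp hp' hr hU'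
    exact ⟨this.1, fun h => this.2 (hrho (by rw [hA.1, hA.2]) h)⟩
  by_cases hB : σ p = -p ∧ σ p' = -p'
  · have : NeZero (2 * L) := ⟨hM.ne'⟩
    obtain ⟨τ, hτ⟩ := HasEnoughRootsOfUnity.exists_primitiveRoot (AlgebraicClosure ℚ) (2 * L)
    have ht0 : τ ≠ 0 := hτ.ne_zero hM.ne'
    have htL : τ ^ L = -1 := by
      rcases hsgn τ hτ.pow_eq_one with h | h
      · exact absurd h.1 (hτ.pow_ne_one_of_pos_of_lt hL0.ne' (by omega))
      · exact h.1
    have hU' : ∀ u ∈ U.image (fun u => u * τ ^ 2), Chd (p * τ) (p' / τ) L u := by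
      intro u hu
      obtain ⟨v, hv, rfl⟩ := Finset.mem_image.1 hu
      obtain ⟨z, w, hz, hw, rfl, h1, h2⟩ := hU v hv
      have hc := cls z w hz hw h1
      rw [hB.1, hB.2] at hc
      rcases hc with ⟨-, -, h⟩ | ⟨a, b, -⟩ | h | h
      · exact absurd (mul_left_cancel₀ two (by linear_combination h1 + h :
          2 * (z + w) = 2 * 0)) h2
      · have e : z * τ + w * τ = (z + w) * τ := by ring
        refine ⟨z * τ, w * τ, by rw [mul_pow, a, htL]; ring, by rw [mul_pow, b, htL]; ring,
          by ring, ?_, ?_⟩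
        · rw [e, h1]; field_simp
        · rw [e]; exact mul_ne_zero h2 ht0
      · have e1 : w = p := mul_left_cancel₀ two (by linear_combination h1 - h)
        have e2 : z = p' * (z * w) := mul_left_cancel₀ two (by linear_combination h1 + h)
        refine absurd (mul_left_cancel₀ (nz z hz) ?_) hr
        rw [← e1]; linear_combination -e2
      · have e1 : z = p := mul_left_cancel₀ two (by linear_combination h1 - h)
        have e2 : w = p' * (z * w) := mul_left_cancel₀ two (by linear_combination h1 + h)
        refine absurd (mul_left_cancel₀ (nz w hw) ?_) hr
        rw [← e1]; linear_combination -e2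
    have := IH (p * τ) (p' / τ) _ (mul_ne_zero hp ht0) (div_ne_zero hp' ht0)
      (by rw [show p * τ * (p' / τ) = p * p' by field_simp]; exact hr) hU'
    rw [rot_card ht0] at this
    refine ⟨this.1, fun h => this.2 ?_⟩
    rw [mul_pow, div_pow, htL, hrho (by rw [hB.1, hB.2]; ring) h]
    ring
  have hc : U.card ≤ 4 := by
    have hsub : U ⊆ (U.filter (fun u => (p' - σ p') * u + (p - σ p) = 0) ∪
        U.filter (fun u => (p' + σ p') * u + (p + σ p) = 0)) ∪
        U.filter (fun u => (p' ^ 2 - σ p' ^ 2) * u ^ 2 + (2 * p * p' + 2 * σ p * σ p' - 4) * u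
          + (p ^ 2 - σ p ^ 2) = 0) := by
      intro u hu
      obtain ⟨z, w, hz, hw, rfl, h1, h2⟩ := hU u hu
      simp only [Finset.mem_union, Finset.mem_filter, hu, true_and]
      rcases cls z w hz hw h1 with ⟨-, -, h⟩ | ⟨-, -, h⟩ | h | h
      · left; left; linear_combination h - h1
      · left; right; linear_combination -h - h1
      · right
        linear_combination (-(z + w + p + p' * (z * w))) * h1 +
          (z - w + σ p - σ p' * (z * w)) * h
      · right
        linear_combination (-(z + w + p + p' * (z * w))) * h1 +
          (w - z + σ p - σ p' * (z * w)) * h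
    refine (Finset.card_le_card hsub).trans ?_
    refine (Finset.card_union_le _ _).trans ?_
    have c1 := Finset.card_union_le (U.filter (fun u => (p' - σ p') * u + (p - σ p) = 0))
      (U.filter (fun u => (p' + σ p') * u + (p + σ p) = 0))
    have c2 := lin_card (p' - σ p') (p - σ p) (by
      rintro ⟨h1, h2⟩
      exact hA ⟨by linear_combination -h2, by linear_combination -h1⟩)
      (U.filter (fun u => (p' - σ p') * u + (p - σ p) = 0)) (by simp)
    have c3 := lin_card (p' + σ p') (p + σ p) (by
      rintro ⟨h1, h2⟩
      exact hB ⟨by linear_combination h2, by linear_combination h1⟩)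
      (U.filter (fun u => (p' + σ p') * u + (p + σ p) = 0)) (by simp)
    have c4 := quad_card (p' ^ 2 - σ p' ^ 2) (2 * p * p' + 2 * σ p * σ p' - 4) (p ^ 2 - σ p ^ 2) (by
      rintro ⟨h1, h2, h3⟩
      have h4 : (σ p * σ p') ^ 2 = (p * p') ^ 2 := by
        linear_combination (-σ p ^ 2) * h1 - p' ^ 2 * h3
      have h5 : (p * p' + σ p * σ p') = 2 := mul_left_cancel₀ two (by linear_combination h2)
      apply hr
      apply mul_left_cancel₀ (by norm_num : (4 : Om) ≠ 0)
      have h6 : σ p * σ p' = 2 - p * p' := by linear_combination h5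
      rw [h6] at h4
      linear_combination -h4)
      (U.filter (fun u => (p' ^ 2 - σ p' ^ 2) * u ^ 2 + (2 * p * p' + 2 * σ p * σ p' - 4) * u
          + (p ^ 2 - σ p ^ 2) = 0)) (by simp)
    omega
  exact ⟨by omega, fun _ => by omega⟩

theorem bd_all (n : ℕ) (hn : 0 < n) : Bd (2 * n) := by
  obtain ⟨k, N, hN, rfl⟩ := Nat.exists_eq_two_pow_mul_odd hn.ne'
  clear hn
  induction k with
  | zero =>
    intro p p' U hp hp' hr hU
    rw [pow_zero, one_mul] at hU ⊢
    exact base_case hN hp hp' hr U hU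
  | succ k ih =>
    have : 2 ^ (k + 1) * N = 2 * (2 ^ k * N) := by ring
    rw [this]
    exact step (even_two_mul _) (by have := hN.pos; positivity) ih

end step

section cplx

lemma exists_iota : Nonempty (Om →+* ℂ) := by
  have : Algebra.IsAlgebraic ℚ Om := by
    have h := @AlgebraicClosure.isAlgebraic ℚ _
    have e : (DivisionRing.toRatAlgebra : Algebra ℚ Om) = AlgebraicClosure.instAlgebra ℚ :=
      Subsingleton.elim _ _
    rw [e]
    exact h
  exact ⟨(IsAlgClosed.lift (R := ℚ) (S := Om) (M := ℂ)).toRingHom⟩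

lemma bdC {n : ℕ} (hn : 0 < n) {p p' : ℂ} (U : Finset ℂ) (hp : p ≠ 0) (hp' : p' ≠ 0)
    (hr : p * p' ≠ 1) (hU : ∀ u ∈ U, Chd p p' (2 * n) u) :
    U.card ≤ 7 ∧ (p ^ (2 * n) = p' ^ (2 * n) → U.card ≤ 6) := by
  obtain ⟨ι⟩ := exists_iota
  have hinj := ι.injective
  have hM : 0 < 2 * n := by omega
  have : NeZero (2 * n) := ⟨hM.ne'⟩
  obtain ⟨ζ, hζ⟩ := HasEnoughRootsOfUnity.exists_primitiveRoot Om (2 * n)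
  have lift : ∀ z : ℂ, z ^ (2 * n) = 1 → ∃ a : Om, a ^ (2 * n) = 1 ∧ ι a = z := by
    intro z hz
    obtain ⟨i, -, rfl⟩ := (hζ.map_of_injective hinj).eq_pow_of_pow_eq_one hz
    refine ⟨ζ ^ i, ?_, by simp⟩
    rw [← pow_mul, mul_comm, pow_mul, hζ.pow_eq_one, one_pow]
  by_cases hc : U.card ≤ 1
  · exact ⟨by omega, fun _ => by omega⟩
  push Not at hc
  obtain ⟨u1, m1, u2, m2, h12⟩ := Finset.one_lt_card.1 hc
  have key : ∃ P P' : Om, ι P = p ∧ ι P' = p' := by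
    obtain ⟨z1, w1, hz1, hw1, rfl, e1, -⟩ := hU u1 m1
    obtain ⟨z2, w2, hz2, hw2, rfl, e2, -⟩ := hU u2 m2
    obtain ⟨a1, -, rfl⟩ := lift z1 hz1
    obtain ⟨a2, -, rfl⟩ := lift z2 hz2
    obtain ⟨b1, -, rfl⟩ := lift w1 hw1
    obtain ⟨b2, -, rfl⟩ := lift w2 hw2
    have hne := sub_ne_zero.2 h12
    have k : ι ((a1 + b1 - (a2 + b2)) / (a1 * b1 - a2 * b2)) = p' := by
      rw [map_div₀]
      simp only [map_sub, map_add, map_mul]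
      rw [div_eq_iff hne]
      linear_combination e1 - e2
    refine ⟨a1 + b1 - ((a1 + b1 - (a2 + b2)) / (a1 * b1 - a2 * b2)) * (a1 * b1), _, ?_, k⟩
    rw [map_sub, map_mul, k]
    simp only [map_add, map_mul]
    linear_combination e1
  obtain ⟨P, P', rfl, rfl⟩ := key
  have hU' : ∀ u ∈ U.preimage ι hinj.injOn, Chd P P' (2 * n) u := by
    intro u hu
    rw [Finset.mem_preimage] at hu
    obtain ⟨z, w, hz, hw, h0, h1, h2⟩ := hU _ hu
    obtain ⟨a, ha, rfl⟩ := lift z hz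
    obtain ⟨b, hb, rfl⟩ := lift w hw
    refine ⟨a, b, ha, hb, hinj (by simpa using h0), hinj (by simpa using h1), ?_⟩
    intro h
    apply h2
    rw [← map_add, h, map_zero]
  have hcard : (U.preimage ι hinj.injOn).card = U.card := by
    rw [← Finset.card_image_of_injective _ hinj]
    congr 1
    ext u
    simp only [Finset.mem_image, Finset.mem_preimage]
    constructor
    · rintro ⟨a, ha, rfl⟩; exact ha
    · intro hu
      obtain ⟨z, w, hz, hw, h0, -⟩ := hU _ hu
      obtain ⟨a, ha, rfl⟩ := lift z hz
      obtain ⟨b, hb, rfl⟩ := lift w hw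
      refine ⟨a * b, ?_, by simpa using h0⟩
      rw [map_mul, h0]; exact hu
  have := bd_all n hn P P' _ (by rintro rfl; simp at hp) (by rintro rfl; simp at hp')
    (by intro h; apply hr; rw [← map_mul, h, map_one]) hU'
  rw [hcard] at this
  refine ⟨this.1, fun h => this.2 (hinj (by simpa using h))⟩

def toC (x : ℝ × ℝ) : ℂ := ⟨x.1, x.2⟩

lemma toC_inj : Function.Injective toC := by
  rintro ⟨a, b⟩ ⟨c, d⟩ h
  simp only [toC, Complex.mk.injEq] at h
  exact Prod.ext h.1 h.2

lemma toC_pt (n k : ℕ) : toC (Real.cos (2 * π * k / n), Real.sin (2 * π * k / n)) =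
    Complex.exp (2 * π * Complex.I / n) ^ k := by
  rw [← Complex.exp_nat_mul]
  have : (k : ℂ) * (2 * π * Complex.I / n) = ((2 * π * k / n : ℝ) : ℂ) * Complex.I := by
    push_cast; ring
  rw [this, Complex.exp_mul_I, ← Complex.ofReal_cos, ← Complex.ofReal_sin]
  apply Complex.ext
  · simp only [toC, Complex.add_re, Complex.ofReal_re, Complex.re_ofReal_mul, Complex.I_re]; ring
  · simp only [toC, Complex.add_im, Complex.ofReal_im, Complex.im_ofReal_mul, Complex.I_im]; ring

lemma ngon_eq (n : ℕ) : regularNgon n = (Finset.range n).image (fun k : ℕ =>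
    (Real.cos (2 * π * k / n), Real.sin (2 * π * k / n))) := by
  unfold regularNgon
  ext v
  simp [Finset.mem_image]

lemma toC_ngon {n : ℕ} (hn : 0 < n) {v : ℝ × ℝ} (hv : v ∈ regularNgon n) :
    toC v ^ n = 1 ∧ toC v * (starRingEnd ℂ) (toC v) = 1 := by
  have h1 : toC v ^ n = 1 := by
    simp only [ngon_eq, Finset.mem_image] at hv
    obtain ⟨k, -, rfl⟩ := hv
    rw [toC_pt, ← pow_mul, mul_comm k n, pow_mul,
      (Complex.isPrimitiveRoot_exp n hn.ne').pow_eq_one, one_pow]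
  refine ⟨h1, ?_⟩
  rw [Complex.mul_conj, Complex.normSq_eq_norm_sq, Complex.norm_eq_one_of_pow_eq_one h1 hn.ne']
  simp

lemma card_ngon {n : ℕ} (hn : 0 < n) : (regularNgon n).card = n := by
  rw [ngon_eq, Finset.card_image_of_injOn, Finset.card_range]
  intro i hi j hj h
  simp only [Finset.coe_range, Set.mem_Iio] at hi hj
  have h' := congrArg toC h
  simp only [toC_pt] at h'
  exact (Complex.isPrimitiveRoot_exp n hn.ne').pow_inj hi hj h'

lemma seg_rel {n : ℕ} (hn : 0 < n) {v w x : ℝ × ℝ} (hv : v ∈ regularNgon n)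
    (hw : w ∈ regularNgon n) (hvw : v ≠ w) (hx : x ∈ openSegment ℝ v w) :
    toC v + toC w = toC x + (starRingEnd ℂ) (toC x) * (toC v * toC w) ∧
    toC x * (starRingEnd ℂ) (toC x) ≠ 1 := by
  obtain ⟨a, b, ha, hb, hab, rfl⟩ := hx
  have h1 := (toC_ngon hn hv).2
  have h2 := (toC_ngon hn hw).2
  have hne : toC v - toC w ≠ 0 := sub_ne_zero.2 (fun h => hvw (toC_inj h))
  have e : toC (a • v + b • w) = a * toC v + b * toC w := by
    apply Complex.ext <;> simp [toC]
  have hab' : (a : ℂ) + b = 1 := by exact_mod_cast hab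
  rw [e]
  simp only [map_add, map_mul, Complex.conj_ofReal]
  constructor
  · linear_combination (-(toC v + toC w)) * hab' - (a * toC w) * h1 - (b * toC v) * h2
  · intro h
    have hc : (starRingEnd ℂ) (toC v - toC w) ≠ 0 := (map_ne_zero _).2 hne
    have h0 : (a : ℂ) * b * ((toC v - toC w) * (starRingEnd ℂ) (toC v - toC w)) ≠ 0 := by
      refine mul_ne_zero (mul_ne_zero ?_ ?_) (mul_ne_zero hne hc)
      · exact_mod_cast ha.ne'
      · exact_mod_cast hb.ne'
    apply h0
    rw [map_sub]
    linear_combination -h + (a + b + 1 : ℂ) * hab' + (a * b + a ^ 2 : ℂ) * h1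
      + (a * b + b ^ 2 : ℂ) * h2

theorem first_part {n : ℕ} (hn : 0 < n) (x : ℝ × ℝ) (hx : x ≠ (0, 0)) :
    ((regularNgon n ×ˢ regularNgon n).filter
        (fun vw => vw.1 ≠ vw.2 ∧ x ∈ openSegment ℝ vw.1 vw.2)).card ≤ 2 * 7 := by
  set S := (regularNgon n ×ˢ regularNgon n).filter
        (fun vw => vw.1 ≠ vw.2 ∧ x ∈ openSegment ℝ vw.1 vw.2) with hS
  rcases S.eq_empty_or_nonempty with h0 | ⟨vw0, h0⟩
  · rw [h0]; simp
  set p := toC x with hp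
  set p' := (starRingEnd ℂ) p with hp'
  have hp0 : p ≠ 0 := by
    intro h
    apply hx
    apply toC_inj
    rw [← hp, h]; rfl
  have hp0' : p' ≠ 0 := by simpa [hp'] using hp0
  have hmem : ∀ vw ∈ S, (toC vw.1 ^ n = 1 ∧ toC vw.2 ^ n = 1 ∧
      toC vw.1 + toC vw.2 = p + p' * (toC vw.1 * toC vw.2)) ∧ p * p' ≠ 1 := by
    intro vw h
    rw [hS, Finset.mem_filter, Finset.mem_product] at h
    obtain ⟨⟨h1, h2⟩, h3, h4⟩ := h
    have := seg_rel hn h1 h2 h3 h4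
    exact ⟨⟨(toC_ngon hn h1).1, (toC_ngon hn h2).1, this.1⟩, this.2⟩
  have hr := (hmem vw0 h0).2
  set f : (ℝ × ℝ) × (ℝ × ℝ) → ℂ := fun vw => toC vw.1 * toC vw.2 with hf
  set I := S.image f with hI
  have hfib : S.card ≤ 2 * I.card := by
    apply Finset.card_le_mul_card_image
    intro u hu
    rw [← Finset.card_image_of_injOn (f := fun vw : (ℝ × ℝ) × (ℝ × ℝ) => toC vw.1)]
    · apply quad_card 1 (-(p + p' * u)) u (by simp)
      intro t ht
      obtain ⟨vw, hvw, rfl⟩ := Finset.mem_image.1 ht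
      rw [Finset.mem_filter] at hvw
      have h1 := (hmem vw hvw.1).1.2.2
      have h2 : toC vw.1 * toC vw.2 = u := hvw.2
      rw [h2] at h1
      linear_combination toC vw.1 * h1 - h2
    · intro a ha b hb hab
      rw [Finset.mem_coe, Finset.mem_filter] at ha hb
      have h1 : toC a.1 * toC a.2 = toC b.1 * toC b.2 := ha.2.trans hb.2.symm
      have h2 : toC a.1 = toC b.1 := hab
      have h3 : toC b.1 ≠ 0 := by
        intro h
        have := (hmem b hb.1).1.1
        rw [h, zero_pow hn.ne'] at this
        exact zero_ne_one this
      rw [h2] at h1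
      exact Prod.ext (toC_inj h2) (toC_inj (mul_left_cancel₀ h3 h1))
  have hchd : ∀ u ∈ I.filter (fun u => p' * u + p ≠ 0), Chd p p' (2 * n) u := by
    intro u hu
    rw [Finset.mem_filter] at hu
    obtain ⟨vw, hvw, rfl⟩ := Finset.mem_image.1 hu.1
    obtain ⟨h1, h2, h3⟩ := (hmem vw hvw).1
    refine ⟨toC vw.1, toC vw.2, ?_, ?_, rfl, h3, ?_⟩
    · rw [mul_comm, pow_mul, h1, one_pow]
    · rw [mul_comm, pow_mul, h2, one_pow]
    · rw [h3, add_comm]; exact hu.2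
  have hb := bdC hn _ hp0 hp0' hr hchd
  have hD := lin_card p' p (fun h => hp0 h.2) (I.filter (fun u => p' * u + p = 0)) (by simp)
  have hsum := Finset.card_filter_add_card_filter_not (s := I) (fun u => p' * u + p = 0)
  have hI7 : I.card ≤ 7 := by
    rcases (I.filter (fun u => p' * u + p = 0)).eq_empty_or_nonempty with h | ⟨u, hu⟩
    · rw [h, Finset.card_empty] at hsum
      have := hb.1
      simp only [ne_eq] at this
      omega
    · rw [Finset.mem_filter] at hu
      obtain ⟨vw, hvw, rfl⟩ := Finset.mem_image.1 hu.1
      obtain ⟨h1, h2, h3⟩ := (hmem vw hvw).1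
      have := hb.2 (by
        have : p = -(p' * f vw) := by linear_combination hu.2
        rw [this, (even_two_mul n).neg_pow, mul_pow]
        have : f vw ^ (2 * n) = 1 := by
          simp only [hf]
          rw [mul_comm 2 n, pow_mul, mul_pow, h1, h2]; simp
        rw [this, mul_one])
      simp only [ne_eq] at this
      omega
  omega

theorem zero_part {n : ℕ} (hn : 0 < n) :
    ((regularNgon n).offDiag.filter
        (fun vw => (0, 0) ∈ openSegment ℝ vw.1 vw.2)).card ≤ 2 * (n / 2) := by
  set T := (regularNgon n).offDiag.filter
        (fun vw => (0, 0) ∈ openSegment ℝ vw.1 vw.2) with hT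
  have hmem : ∀ vw ∈ T, vw.1 ∈ regularNgon n ∧ vw.2 ∈ regularNgon n ∧
      toC vw.2 = - toC vw.1 := by
    intro vw h
    rw [hT, Finset.mem_filter, Finset.mem_offDiag] at h
    obtain ⟨⟨h1, h2, h3⟩, h4⟩ := h
    have h5 := (seg_rel hn h1 h2 h3 h4).1
    have h6 : toC (0, 0) = 0 := rfl
    rw [h6, map_zero] at h5
    exact ⟨h1, h2, by linear_combination h5⟩
  rcases Nat.even_or_odd n with he | ho
  · rw [Nat.two_mul_div_two_of_even he]
    calc T.card = (T.image Prod.fst).card := by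
          rw [Finset.card_image_of_injOn]
          intro a ha b hb hab
          have h1 := (hmem a ha).2.2
          have h2 := (hmem b hb).2.2
          rw [hab, ← h2] at h1
          exact Prod.ext hab (toC_inj h1)
      _ ≤ (regularNgon n).card := by
          apply Finset.card_le_card
          intro v hv
          obtain ⟨vw, h, rfl⟩ := Finset.mem_image.1 hv
          exact (hmem vw h).1
      _ = n := card_ngon hn
  · have : T = ∅ := by
      rw [Finset.eq_empty_iff_forall_notMem]
      intro vw h
      obtain ⟨h1, h2, h3⟩ := hmem vw h
      have h4 := (toC_ngon hn h1).1
      have h5 := (toC_ngon hn h2).1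
      rw [h3, ho.neg_pow, h4] at h5
      norm_num at h5
    rw [this]; simp

theorem second_part {n : ℕ} (hn : 0 < n) (B : Finset (ℝ × ℝ))
    (hB : Blocks (B : Set (ℝ × ℝ)) ((regularNgon n : Set (ℝ × ℝ)))) :
    n * (n - 1) ≤ 14 * B.card + 2 * (n / 2) := by
  have h1 : (regularNgon n).offDiag.card = n * (n - 1) := by
    rw [Finset.offDiag_card, card_ngon hn, Nat.mul_sub, mul_one]
  rw [← h1]
  have hsub : (regularNgon n).offDiag ⊆
      (B.biUnion (fun b => if b = (0, 0) then ∅ else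
        (regularNgon n ×ˢ regularNgon n).filter
        (fun vw => vw.1 ≠ vw.2 ∧ b ∈ openSegment ℝ vw.1 vw.2))) ∪
      ((regularNgon n).offDiag.filter
        (fun vw => (0, 0) ∈ openSegment ℝ vw.1 vw.2)) := by
    intro vw h
    have h' := h
    rw [Finset.mem_offDiag] at h
    obtain ⟨b, hb, hbs⟩ := hB.2 vw.1 h.1 vw.2 h.2.1 h.2.2
    rw [Finset.mem_union]
    by_cases hb0 : b = (0, 0)
    · right
      rw [Finset.mem_filter]
      exact ⟨h', hb0 ▸ hbs⟩
    · left
      rw [Finset.mem_biUnion]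
      refine ⟨b, hb, ?_⟩
      rw [if_neg hb0, Finset.mem_filter, Finset.mem_product]
      exact ⟨⟨h.1, h.2.1⟩, h.2.2, hbs⟩
  refine (Finset.card_le_card hsub).trans ((Finset.card_union_le _ _).trans ?_)
  refine Nat.add_le_add ?_ (zero_part hn)
  rw [mul_comm]
  apply Finset.card_biUnion_le_card_mul
  intro b hb
  split_ifs with h
  · simp
  · exact first_part hn b h

end cplx

end NG

/-- For `n ≥ 3` equally spaced points on a circle, every point other than the centre
lies on at most `7` open chords (counted here as ordered pairs, so at most `14`);
consequently every blocking set has at least `(n(n-1)/2 - ⌊n/2⌋)/7` points. -/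
theorem regular_ngon_blocking (n : ℕ) (hn : 3 ≤ n) :
    (∀ x : ℝ × ℝ, x ≠ (0, 0) →
      ((regularNgon n ×ˢ regularNgon n).filter
        (fun vw => vw.1 ≠ vw.2 ∧ x ∈ openSegment ℝ vw.1 vw.2)).card ≤ 2 * 7) ∧
    (∀ B : Finset (ℝ × ℝ),
      Blocks (B : Set (ℝ × ℝ)) ((regularNgon n : Set (ℝ × ℝ))) →
      ((((n * (n - 1) / 2 : ℕ) : ℝ) - ((n / 2 : ℕ) : ℝ)) / 7) ≤ B.card) := by
  have hn0 : 0 < n := by omega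
  refine ⟨fun x hx => NG.first_part hn0 x hx, fun B hB => ?_⟩
  have h := NG.second_part hn0 B hB
  have h2 : n * (n - 1) / 2 ≤ 7 * B.card + n / 2 := by omega
  have h3 : ((n * (n - 1) / 2 : ℕ) : ℝ) ≤ 7 * (B.card : ℝ) + ((n / 2 : ℕ) : ℝ) := by
    exact_mod_cast h2
  rw [div_le_iff₀ (by norm_num)]
  linarith
end
end
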